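/- arXiv:2102.10025 — 2 statements merged into one kernel-verified Lean document; each statement's English description precedes it below -/
import Mathlib

section
/- Let α ≥ 1/2 and θ ∈ ℝ. For every S > θ the function x ↦ log P_θ(x) is differentiable at S with derivative −h_θ(S). Moreover, for every S > θ + 1: if α ≥ 1, then its second derivative at S satisfies |d²/dx² log P_θ(x)|_{x=S}| ≤ α³(α−1)(S−θ)^{3α−2}/(α(S−θ)^α − (α−1))²; and if 1/2 ≤ α < 1, then |d²/dx² log P_θ(x)|_{x=S}| ≤ α(1−α)(S−θ)^{α−2}. -/
open MeasureTheory Filter Set Topology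

/-- Normalization constant `C₀ = (∫ exp(-|x|^α) dx)⁻¹`. -/
noncomputable def C0 (α : ℝ) : ℝ := (∫ x : ℝ, Real.exp (-(|x| ^ α)))⁻¹

/-- Density `f_θ(x) = C₀ exp(-|x-θ|^α)`. -/
noncomputable def fd (α θ x : ℝ) : ℝ := C0 α * Real.exp (-(|x - θ| ^ α))

/-- Tail probability `P_θ(S) = ∫_S^∞ f_θ(x) dx`. -/
noncomputable def Ptail (α θ S : ℝ) : ℝ := ∫ x in Set.Ioi S, fd α θ x

/-- Conditional mean above `S`: `μ_θ(S) = (∫_S^∞ x f_θ(x) dx) / P_θ(S)`. -/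
noncomputable def muTail (α θ S : ℝ) : ℝ := (∫ x in Set.Ioi S, x * fd α θ x) / Ptail α θ S

/-- `g_θ(S) = P_θ(S) / ∫_S^∞ P_θ(x) dx`. -/
noncomputable def gfun (α θ S : ℝ) : ℝ := Ptail α θ S / ∫ x in Set.Ioi S, Ptail α θ x

/-- Hazard rate `h_θ(S) = f_θ(S)/P_θ(S)`. -/
noncomputable def hazard (α θ S : ℝ) : ℝ := fd α θ S / Ptail α θ S

/-- The unnormalized, centred tail integral `∫_t^∞ exp(-u^α) du`. -/
noncomputable def expTail (α t : ℝ) : ℝ := ∫ u in Set.Ioi t, Real.exp (-(u ^ α))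

lemma integrableOn_exp_neg_rpow_Ioi {α t : ℝ} (hα : 0 < α) (ht : 0 ≤ t) :
    IntegrableOn (fun u : ℝ => Real.exp (-(u ^ α))) (Set.Ioi t) := by
  have h := integrableOn_rpow_mul_exp_neg_rpow (s := 0) (by norm_num) hα
  simp only [Real.rpow_zero, one_mul] at h
  exact h.mono_set (Set.Ioi_subset_Ioi ht)

lemma expTail_pos {α t : ℝ} (hα : 0 < α) (ht : 0 ≤ t) : 0 < expTail α t := by
  have : NeZero (volume.restrict (Set.Ioi t)) := ⟨by simp⟩
  exact integral_exp_pos (integrableOn_exp_neg_rpow_Ioi hα ht)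

lemma expTail_eq_sub {α t : ℝ} (hα : 0 < α) (ht : 0 ≤ t) :
    expTail α t = expTail α 0 - ∫ u in (0 : ℝ)..t, Real.exp (-(u ^ α)) :=
  eq_sub_of_add_eq' (intervalIntegral.integral_interval_add_Ioi
    (integrableOn_exp_neg_rpow_Ioi hα le_rfl) (integrableOn_exp_neg_rpow_Ioi hα ht))

lemma hasDerivAt_expTail {α t : ℝ} (hα : 0 < α) (ht : 0 < t) :
    HasDerivAt (expTail α) (-Real.exp (-(t ^ α))) t := by
  have hc : Continuous fun u : ℝ => Real.exp (-(u ^ α)) :=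
    Real.continuous_exp.comp (Real.continuous_rpow_const hα.le).neg
  have h := (hc.integral_hasStrictDerivAt 0 t).hasDerivAt.const_sub (expTail α 0)
  refine h.congr_of_eventuallyEq ?_
  filter_upwards [eventually_gt_nhds ht] with u hu using expTail_eq_sub hα hu.le

lemma tendsto_expTail_atTop {α : ℝ} (hα : 0 < α) : Tendsto (expTail α) atTop (𝓝 0) := by
  have h := (intervalIntegral_tendsto_integral_Ioi 0
    (integrableOn_exp_neg_rpow_Ioi hα le_rfl) tendsto_id).const_sub (expTail α 0)
  rw [← expTail, sub_self] at h
  refine h.congr' ?_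
  filter_upwards [eventually_ge_atTop 0] with u hu using (expTail_eq_sub hα hu).symm

lemma hasDerivAt_exp_neg_rpow {α t : ℝ} (ht : 0 < t) :
    HasDerivAt (fun u : ℝ => Real.exp (-(u ^ α)))
      (-(α * t ^ (α - 1)) * Real.exp (-(t ^ α))) t := by
  rw [mul_comm]
  exact (Real.hasDerivAt_rpow_const (p := α) (Or.inl ht.ne')).neg.exp

lemma tendsto_rpow_mul_exp_neg_rpow_atTop {α : ℝ} (hα : 0 < α) (s : ℝ) :
    Tendsto (fun u : ℝ => u ^ s * Real.exp (-(u ^ α))) atTop (𝓝 0) := by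
  refine ((tendsto_rpow_mul_exp_neg_mul_atTop_nhds_zero (s / α) 1 one_pos).comp
    (tendsto_rpow_atTop hα)).congr' ?_
  filter_upwards [eventually_ge_atTop 0] with u hu
  simp [← Real.rpow_mul hu, mul_div_cancel₀ _ hα.ne']

/-- A function with nonnegative derivative on `[t, ∞)` which tends to `0` is nonpositive at `t`. -/
lemma nonpos_of_hasDerivAt_nonneg_of_tendsto {f f' : ℝ → ℝ} {t : ℝ}
    (hf : ∀ u, t ≤ u → HasDerivAt f (f' u) u) (hf' : ∀ u, t ≤ u → 0 ≤ f' u)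
    (hlim : Tendsto f atTop (𝓝 0)) : f t ≤ 0 := by
  have hmono : MonotoneOn f (Set.Ici t) := by
    refine monotoneOn_of_hasDerivWithinAt_nonneg (convex_Ici t)
      (fun u hu => (hf u hu).continuousAt.continuousWithinAt)
      (fun u hu => (hf u (interior_subset hu)).hasDerivWithinAt)
      (fun u hu => hf' u (interior_subset hu))
  refine ge_of_tendsto hlim ?_
  filter_upwards [eventually_ge_atTop t] with u hu using hmono Set.self_mem_Ici hu hu

/-- A function with nonpositive derivative on `[t, ∞)` which tends to `0` is nonnegative at `t`. -/
lemma nonneg_of_hasDerivAt_nonpos_of_tendsto {f f' : ℝ → ℝ} {t : ℝ}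
    (hf : ∀ u, t ≤ u → HasDerivAt f (f' u) u) (hf' : ∀ u, t ≤ u → f' u ≤ 0)
    (hlim : Tendsto f atTop (𝓝 0)) : 0 ≤ f t :=
  neg_nonpos.1 (nonpos_of_hasDerivAt_nonneg_of_tendsto (f := fun u => -f u)
    (fun u hu => (hf u hu).neg) (fun u hu => neg_nonneg.2 (hf' u hu)) (by simpa using hlim.neg))

lemma hasDerivAt_const_mul_expTail_sub {α c u : ℝ} (hα : 0 < α) (hu : 0 < u) :
    HasDerivAt (fun u => c * expTail α u - Real.exp (-(u ^ α)))
      ((α * u ^ (α - 1) - c) * Real.exp (-(u ^ α))) u := by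
  convert! ((hasDerivAt_expTail hα hu).const_mul c).sub (hasDerivAt_exp_neg_rpow hu) using 1
  ring

lemma tendsto_const_mul_expTail_sub {α c : ℝ} (hα : 0 < α) :
    Tendsto (fun u => c * expTail α u - Real.exp (-(u ^ α))) atTop (𝓝 0) := by
  simpa using ((tendsto_expTail_atTop hα).const_mul c).sub
    (tendsto_rpow_mul_exp_neg_rpow_atTop hα 0)

lemma hasDerivAt_const_mul_expTail_sub_rpow_mul {α c u : ℝ} (hα : 0 < α) (hu : 0 < u) :
    HasDerivAt (fun u => c * expTail α u - u ^ (1 - α) * Real.exp (-(u ^ α)))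
      ((α + (α - 1) * u ^ (-α) - c) * Real.exp (-(u ^ α))) u := by
  convert! ((hasDerivAt_expTail hα hu).const_mul c).sub
    ((Real.hasDerivAt_rpow_const (p := 1 - α) (Or.inl hu.ne')).mul
      (hasDerivAt_exp_neg_rpow hu)) using 1
  have h : u ^ (1 - α) * u ^ (α - 1) = 1 := by
    rw [← Real.rpow_add hu]; simp
  rw [show 1 - α - 1 = -α by ring]
  linear_combination (-α * Real.exp (-(u ^ α))) * h

lemma tendsto_const_mul_expTail_sub_rpow_mul {α c : ℝ} (hα : 0 < α) :
    Tendsto (fun u => c * expTail α u - u ^ (1 - α) * Real.exp (-(u ^ α))) atTop (𝓝 0) := by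
  simpa using ((tendsto_expTail_atTop hα).const_mul c).sub
    (tendsto_rpow_mul_exp_neg_rpow_atTop hα (1 - α))

/-- The hazard rate of the centred law, as a function of the distance to the centre. -/
noncomputable def expHazard (α t : ℝ) : ℝ := Real.exp (-(t ^ α)) / expTail α t

lemma expHazard_pos {α t : ℝ} (hα : 0 < α) (ht : 0 ≤ t) : 0 < expHazard α t :=
  div_pos (Real.exp_pos _) (expTail_pos hα ht)

lemma hasDerivAt_expHazard {α t : ℝ} (hα : 0 < α) (ht : 0 < t) :
    HasDerivAt (expHazard α) (expHazard α t * (expHazard α t - α * t ^ (α - 1))) t := by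
  have hT := (expTail_pos hα ht.le).ne'
  convert! (hasDerivAt_exp_neg_rpow ht).div (hasDerivAt_expTail hα ht) hT using 1
  rw [expHazard]
  field_simp
  ring

lemma le_expHazard_of_one_le {α t : ℝ} (hα : 1 ≤ α) (ht : 0 < t) :
    α * t ^ (α - 1) ≤ expHazard α t := by
  have hα0 : 0 < α := by linarith
  rw [expHazard, le_div_iff₀ (expTail_pos hα0 ht.le), ← sub_nonpos]
  refine nonpos_of_hasDerivAt_nonneg_of_tendsto
    (f := fun u => α * t ^ (α - 1) * expTail α u - Real.exp (-(u ^ α)))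
    (fun u hu => hasDerivAt_const_mul_expTail_sub hα0 (ht.trans_le hu)) (fun u hu => ?_)
    (tendsto_const_mul_expTail_sub hα0)
  have h : t ^ (α - 1) ≤ u ^ (α - 1) := Real.rpow_le_rpow ht.le hu (by linarith)
  exact mul_nonneg (by nlinarith) (Real.exp_pos _).le

lemma expHazard_le_of_le_one {α t : ℝ} (hα0 : 0 < α) (hα : α ≤ 1) (ht : 0 < t) :
    expHazard α t ≤ α * t ^ (α - 1) := by
  rw [expHazard, div_le_iff₀ (expTail_pos hα0 ht.le), ← sub_nonneg]
  refine nonneg_of_hasDerivAt_nonpos_of_tendsto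
    (f := fun u => α * t ^ (α - 1) * expTail α u - Real.exp (-(u ^ α)))
    (fun u hu => hasDerivAt_const_mul_expTail_sub hα0 (ht.trans_le hu)) (fun u hu => ?_)
    (tendsto_const_mul_expTail_sub hα0)
  have h : u ^ (α - 1) ≤ t ^ (α - 1) := Real.rpow_le_rpow_of_nonpos ht hu (by linarith)
  exact mul_nonpos_of_nonpos_of_nonneg (by nlinarith) (Real.exp_pos _).le

lemma rpow_mul_add_mul_rpow_neg {α t c d : ℝ} (ht : 0 < t) :
    (c + d * t ^ (-α)) * t ^ (α - 1) = c * t ^ (α - 1) + d / t := by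
  have h : t ^ (-α) * t ^ (α - 1) = t⁻¹ := by
    rw [← Real.rpow_add ht, show -α + (α - 1) = -1 by ring, Real.rpow_neg_one]
  rw [div_eq_mul_inv]
  linear_combination d * h

lemma rpow_one_sub_mul_eq {α t E : ℝ} (ht : 0 < t) :
    t ^ (1 - α) * E * t ^ (α - 1) = E := by
  have h : t ^ (1 - α) * t ^ (α - 1) = 1 := by
    rw [← Real.rpow_add ht]; simp
  linear_combination E * h

lemma expHazard_le_of_one_le {α t : ℝ} (hα : 1 ≤ α) (ht : 0 < t) :
    expHazard α t ≤ α * t ^ (α - 1) + (α - 1) / t := by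
  have hα0 : 0 < α := by linarith
  have key : t ^ (1 - α) * Real.exp (-(t ^ α)) ≤ (α + (α - 1) * t ^ (-α)) * expTail α t := by
    rw [← sub_nonneg]
    refine nonneg_of_hasDerivAt_nonpos_of_tendsto (f := fun u =>
      (α + (α - 1) * t ^ (-α)) * expTail α u - u ^ (1 - α) * Real.exp (-(u ^ α)))
      (fun u hu => hasDerivAt_const_mul_expTail_sub_rpow_mul hα0 (ht.trans_le hu))
      (fun u hu => ?_) (tendsto_const_mul_expTail_sub_rpow_mul hα0)
    have h : u ^ (-α) ≤ t ^ (-α) := Real.rpow_le_rpow_of_nonpos ht hu (by linarith)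
    exact mul_nonpos_of_nonpos_of_nonneg (by nlinarith) (Real.exp_pos _).le
  rw [expHazard, div_le_iff₀ (expTail_pos hα0 ht.le), ← rpow_mul_add_mul_rpow_neg ht]
  have := mul_le_mul_of_nonneg_right key (Real.rpow_pos_of_pos ht (α - 1)).le
  rw [rpow_one_sub_mul_eq ht] at this
  linarith

lemma le_expHazard_of_le_one {α t : ℝ} (hα0 : 0 < α) (hα : α ≤ 1) (ht : 0 < t) :
    α * t ^ (α - 1) + (α - 1) / t ≤ expHazard α t := by
  have key : (α + (α - 1) * t ^ (-α)) * expTail α t ≤ t ^ (1 - α) * Real.exp (-(t ^ α)) := by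
    rw [← sub_nonpos]
    refine nonpos_of_hasDerivAt_nonneg_of_tendsto (f := fun u =>
      (α + (α - 1) * t ^ (-α)) * expTail α u - u ^ (1 - α) * Real.exp (-(u ^ α)))
      (fun u hu => hasDerivAt_const_mul_expTail_sub_rpow_mul hα0 (ht.trans_le hu))
      (fun u hu => ?_) (tendsto_const_mul_expTail_sub_rpow_mul hα0)
    have h : u ^ (-α) ≤ t ^ (-α) := Real.rpow_le_rpow_of_nonpos ht hu (by linarith)
    exact mul_nonneg (by nlinarith) (Real.exp_pos _).le
  rw [expHazard, le_div_iff₀ (expTail_pos hα0 ht.le), ← rpow_mul_add_mul_rpow_neg ht]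
  have := mul_le_mul_of_nonneg_right key (Real.rpow_pos_of_pos ht (α - 1)).le
  rw [rpow_one_sub_mul_eq ht] at this
  linarith

lemma C0_pos {α : ℝ} (hα : 0 < α) : 0 < C0 α := by
  rw [C0, integral_comp_abs (f := fun x => Real.exp (-(x ^ α))), ← expTail]
  have := expTail_pos hα le_rfl
  positivity

lemma Ptail_eq {α θ S : ℝ} (hS : θ ≤ S) : Ptail α θ S = C0 α * expTail α (S - θ) := by
  have h := (measurePreserving_sub_right volume θ).setIntegral_preimage_emb
    (measurableEmbedding_subRight θ) (fun u => Real.exp (-(u ^ α))) (Set.Ioi (S - θ))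
  rw [expTail, ← h, ← integral_const_mul, Ptail]
  have hpre : (fun x => x - θ) ⁻¹' Set.Ioi (S - θ) = Set.Ioi S := by
    ext x; simp
  rw [hpre]
  refine setIntegral_congr_fun measurableSet_Ioi fun x hx => ?_
  have : 0 ≤ x - θ := by linarith [Set.mem_Ioi.1 hx]
  simp only [fd, abs_of_nonneg this]

lemma hazard_eq {α θ S : ℝ} (hα : 0 < α) (hS : θ ≤ S) :
    hazard α θ S = expHazard α (S - θ) := by
  rw [hazard, Ptail_eq hS, fd, abs_of_nonneg (sub_nonneg.2 hS), expHazard,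
    mul_div_mul_left _ _ (C0_pos hα).ne']

lemma hasDerivAt_log_Ptail {α θ S : ℝ} (hα : 0 < α) (hS : θ < S) :
    HasDerivAt (fun x => Real.log (Ptail α θ x)) (-(hazard α θ S)) S := by
  have ht : 0 < S - θ := sub_pos.2 hS
  have hT := expTail_pos hα ht.le
  have hC := C0_pos hα
  have h := ((((hasDerivAt_expTail hα ht).comp_sub_const S θ).const_mul (C0 α)).log
    (mul_pos hC hT).ne').congr_of_eventuallyEq
    (f₁ := fun x => Real.log (Ptail α θ x)) (by
      filter_upwards [eventually_gt_nhds hS] with x hx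
      rw [Ptail_eq hx.le])
  convert! h using 1
  rw [hazard_eq hα hS.le, expHazard, mul_div_mul_left _ _ hC.ne', neg_div]

lemma deriv_deriv_log_Ptail {α θ S : ℝ} (hα : 0 < α) (hS : θ < S) :
    deriv (deriv (fun x => Real.log (Ptail α θ x))) S =
      -(expHazard α (S - θ) * (expHazard α (S - θ) - α * (S - θ) ^ (α - 1))) := by
  have h := ((hasDerivAt_expHazard hα (sub_pos.2 hS)).comp_sub_const S θ).neg
  rw [← h.deriv]
  refine Filter.EventuallyEq.deriv_eq ?_
  filter_upwards [eventually_gt_nhds hS] with x hx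
  rw [(hasDerivAt_log_Ptail hα hx).deriv, hazard_eq hα hx.le]
  rfl

/-- Derivative of `log P_θ` is `−h_θ`, with bounds on the second derivative. -/
theorem stmt_3 (α : ℝ) (hα : 1/2 ≤ α) (θ : ℝ) :
    (∀ S, θ < S → HasDerivAt (fun x => Real.log (Ptail α θ x)) (-(hazard α θ S)) S) ∧
    (∀ S, θ + 1 < S →
      (1 ≤ α → |deriv (deriv (fun x => Real.log (Ptail α θ x))) S| ≤
        α ^ 3 * (α - 1) * (S - θ) ^ (3 * α - 2) / (α * (S - θ) ^ α - (α - 1)) ^ 2) ∧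
      (α < 1 → |deriv (deriv (fun x => Real.log (Ptail α θ x))) S| ≤
        α * (1 - α) * (S - θ) ^ (α - 2))) := by
  have hα0 : 0 < α := by linarith
  refine ⟨fun S hS => hasDerivAt_log_Ptail hα0 hS, fun S hS => ?_⟩
  rw [deriv_deriv_log_Ptail hα0 (by linarith), abs_neg]
  have ht1 : 1 < S - θ := by linarith
  generalize S - θ = t at ht1
  have ht : 0 < t := by linarith
  have hpos := expHazard_pos hα0 ht.le
  have hpow : t ^ (α - 1) = t ^ α / t := Real.rpow_sub_one ht.ne' α
  refine ⟨fun h1 => ?_, fun h1 => ?_⟩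
  · have hlow := le_expHazard_of_one_le h1 ht
    have hup := expHazard_le_of_one_le h1 ht
    have hp1 : 1 ≤ t ^ α := Real.one_le_rpow ht1.le hα0.le
    have hpow3 : t ^ (3 * α - 2) = (t ^ α) ^ 3 / t ^ 2 := by
      rw [Real.rpow_sub ht, mul_comm, Real.rpow_mul ht.le]
      norm_cast
    rw [abs_of_nonneg (mul_nonneg hpos.le (sub_nonneg.2 hlow)), hpow3]
    rw [hpow] at *
    generalize t ^ α = y at *
    have hq : 0 < α * y - (α - 1) := by nlinarith
    calc expHazard α t * (expHazard α t - α * (y / t))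
        ≤ (α * (y / t) + (α - 1) / t) * ((α - 1) / t) :=
          mul_le_mul hup (by linarith) (by linarith) (hpos.le.trans hup)
      _ = (α - 1) / t ^ 2 * (α * y + (α - 1)) := by field_simp
      _ ≤ (α - 1) / t ^ 2 * ((α * y) ^ 3 / (α * y - (α - 1)) ^ 2) := by
          refine mul_le_mul_of_nonneg_left ?_ (div_nonneg (by linarith) (by positivity))
          rw [le_div_iff₀ (by positivity)]
          have hy : 0 ≤ α * y := by positivity
          have hd : 0 ≤ α - 1 := by linarith
          nlinarith [mul_nonneg (mul_nonneg hy hy) hd, mul_nonneg (mul_nonneg hd hd) hq.le]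
      _ = _ := by field_simp
  · have hup := expHazard_le_of_le_one hα0 h1.le ht
    have hlow := le_expHazard_of_le_one hα0 h1.le ht
    have hpow2 : t ^ (α - 2) = t ^ (α - 1) / t := by
      rw [← Real.rpow_sub_one ht.ne']; ring_nf
    rw [abs_of_nonpos (mul_nonpos_of_nonneg_of_nonpos hpos.le (sub_nonpos.2 hup)), ← mul_neg,
      neg_sub, hpow2]
    calc expHazard α t * (α * t ^ (α - 1) - expHazard α t)
        ≤ α * t ^ (α - 1) * ((1 - α) / t) := by
          refine mul_le_mul hup ?_ (by linarith) (by positivity)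
          rw [← neg_sub α 1, neg_div]
          linarith
      _ = _ := by ring
end

section
/- Let α ≥ 1/2 and γ ∈ (0,1), and suppose θ ∈ ℝ is such that S*(θ,γ) > θ. Then the map ϑ ↦ S*(ϑ,γ) is differentiable at θ with derivative ∂S*(θ,γ)/∂θ = P_θ(S*(θ,γ))/(P_θ(S*(θ,γ)) + (1−γ)/γ); in particular this derivative lies in (0,1) and equals 1 − 1/(S*(θ,γ)·g_θ(S*(θ,γ)) + 1). -/
open MeasureTheory Filter Set Topology

theorem integrableOn_Ioi_of_continuous {f : ℝ → ℝ} (hf : Continuous f) {a : ℝ}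
    (ha : IntegrableOn f (Ioi a)) (b : ℝ) : IntegrableOn f (Ioi b) := by
  have h : IntegrableOn f (Icc b a ∪ Ioi a) :=
    hf.continuousOn.integrableOn_Icc.union ha
  refine h.mono_set fun x hx => ?_
  rcases le_or_gt x a with hxa | hxa
  · exact Or.inl ⟨le_of_lt hx, hxa⟩
  · exact Or.inr hxa

theorem hasDerivAt_integral_Ioi {f : ℝ → ℝ} (hf : Continuous f) {a : ℝ}
    (ha : IntegrableOn f (Ioi a)) (s : ℝ) :
    HasDerivAt (fun t => ∫ x in Ioi t, f x) (-f s) s := by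
  have h : (fun t => ∫ x in Ioi t, f x) = fun t => (∫ x in Ioi a, f x) - ∫ x in a..t, f x := by
    funext t
    rw [← intervalIntegral.integral_Ioi_sub_Ioi' ha (integrableOn_Ioi_of_continuous hf ha t)]
    ring
  rw [h]
  exact (hf.integral_hasStrictDerivAt a s).hasDerivAt.const_sub _

theorem setIntegral_Ioi_comp_sub_right (f : ℝ → ℝ) (s d : ℝ) :
    ∫ x in Ioi s, f (x - d) = ∫ x in Ioi (s - d), f x := by
  have h := (measurePreserving_sub_right volume d).setIntegral_preimage_emb
    (measurableEmbedding_subRight d) f (Ioi (s - d))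
  simpa using h

theorem fd_eq_fd_zero (α θ x : ℝ) : fd α θ x = fd α 0 (x - θ) := by
  simp [fd]

theorem Ptail_eq_Ptail_zero (α θ S : ℝ) : Ptail α θ S = Ptail α 0 (S - θ) := by
  simp only [Ptail, fd_eq_fd_zero α θ]
  exact setIntegral_Ioi_comp_sub_right (fd α 0) S θ

theorem integral_Ioi_Ptail (α θ S : ℝ) :
    ∫ x in Ioi S, Ptail α θ x = ∫ x in Ioi (S - θ), Ptail α 0 x := by
  simp only [Ptail_eq_Ptail_zero α θ]
  exact setIntegral_Ioi_comp_sub_right (Ptail α 0) S θ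

theorem continuous_fd {α : ℝ} (hα : 0 ≤ α) (θ : ℝ) : Continuous (fd α θ) := by
  unfold fd
  have h : Continuous fun x : ℝ => |x - θ| ^ α :=
    (by fun_prop : Continuous fun x : ℝ => |x - θ|).rpow_const fun _ => Or.inr hα
  fun_prop

theorem integrable_fd_zero {α : ℝ} (h : C0 α ≠ 0) : Integrable (fd α 0) := by
  have hi : Integrable fun x : ℝ => Real.exp (-(|x| ^ α)) := by
    by_contra hn
    exact h (by rw [C0, integral_undef hn, inv_zero])
  have h_fd : fd α 0 = fun x => C0 α * Real.exp (-(|x| ^ α)) := by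
    funext x
    simp [fd]
  rw [h_fd]
  exact hi.const_mul (C0 α)

theorem C0_nonneg (α : ℝ) : 0 ≤ C0 α :=
  inv_nonneg.2 (integral_nonneg fun _ => (Real.exp_pos _).le)

theorem Ptail_zero_pos {α : ℝ} (h : C0 α ≠ 0) (S : ℝ) : 0 < Ptail α 0 S := by
  have hpos : ∀ x, 0 < fd α 0 x := fun x =>
    mul_pos (lt_of_le_of_ne (C0_nonneg α) h.symm) (Real.exp_pos _)
  rw [Ptail, setIntegral_pos_iff_support_of_nonneg_ae
    (Eventually.of_forall fun x => (hpos x).le) (integrable_fd_zero h).integrableOn]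
  have hsupp : Function.support (fd α 0) = univ := by
    ext x
    simp [(hpos x).ne']
  simp [hsupp]

theorem continuous_Ptail_zero {α : ℝ} (hα : 0 ≤ α) (h : C0 α ≠ 0) : Continuous (Ptail α 0) :=
  continuous_iff_continuousAt.2 fun s =>
    (hasDerivAt_integral_Ioi (continuous_fd hα 0)
      (integrable_fd_zero h).integrableOn (a := 0) s).continuousAt

/-- A right inverse of a function on `ℝ` with everywhere negative derivative is differentiable. -/
theorem hasDerivAt_of_rightInverse_of_deriv_neg {φ φ' u : ℝ → ℝ}
    (hφ : ∀ x, HasDerivAt φ (φ' x) x) (hneg : ∀ x, φ' x < 0)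
    (hu : Function.RightInverse u φ) (y : ℝ) : HasDerivAt u (φ' (u y))⁻¹ y := by
  have hanti : StrictAnti φ := strictAnti_of_deriv_neg fun x => by
    rw [(hφ x).deriv]
    exact hneg x
  have hu_anti : Antitone u := fun a b hab => by
    rw [← hanti.le_iff_ge, hu a, hu b]
    exact hab
  have hsurj : Function.Surjective u := fun x => ⟨φ x, hanti.injective (hu (φ x))⟩
  have hcont : Continuous fun x => -u x :=
    Monotone.continuous_of_surjective hu_anti.neg (neg_surjective.comp hsurj)
  have hcont' : Continuous u := continuous_neg_iff.1 hcont
  exact HasDerivAt.of_local_left_inverse hcont'.continuousAt (hφ _) (hneg _).ne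
    (Eventually.of_forall hu)

/-- Differentiability of the optimal threshold in the location parameter:
`∂S*(θ,γ)/∂θ = P_θ(S*)/(P_θ(S*) + (1−γ)/γ) ∈ (0,1)`, and this equals
`1 − 1/(S*·g_θ(S*) + 1)`. -/
theorem stmt_9 (α : ℝ) (hα : 1/2 ≤ α)
    (Sstar : ℝ → ℝ → ℝ)
    (hS : ∀ θ : ℝ, ∀ γ ∈ Set.Ioo (0:ℝ) 1,
      0 < Sstar θ γ ∧
      ((1-γ)/γ) * Sstar θ γ = (∫ x in Set.Ioi (Sstar θ γ), Ptail α θ x) ∧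
      ∀ S, 0 < S → ((1-γ)/γ) * S = (∫ x in Set.Ioi S, Ptail α θ x) → S = Sstar θ γ)
    (γ : ℝ) (hγ : γ ∈ Set.Ioo (0:ℝ) 1) (θ : ℝ) (hgt : θ < Sstar θ γ) :
    HasDerivAt (fun ϑ => Sstar ϑ γ)
      (Ptail α θ (Sstar θ γ) / (Ptail α θ (Sstar θ γ) + (1-γ)/γ)) θ ∧
    Ptail α θ (Sstar θ γ) / (Ptail α θ (Sstar θ γ) + (1-γ)/γ) ∈ Set.Ioo (0:ℝ) 1 ∧
    Ptail α θ (Sstar θ γ) / (Ptail α θ (Sstar θ γ) + (1-γ)/γ)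
      = 1 - 1 / (Sstar θ γ * gfun α θ (Sstar θ γ) + 1) := by
  have hα0 : 0 ≤ α := by linarith
  obtain ⟨c, hc⟩ : ∃ c, c = (1 - γ) / γ := ⟨_, rfl⟩
  have hcpos : 0 < c := by
    rw [hc]
    exact div_pos (sub_pos.2 hγ.2) hγ.1
  have hSpos : ∀ ϑ, 0 < Sstar ϑ γ := fun ϑ => (hS ϑ γ hγ).1
  have hSeq : ∀ ϑ, c * Sstar ϑ γ = ∫ x in Ioi (Sstar ϑ γ - ϑ), Ptail α 0 x := fun ϑ => by
    rw [hc, (hS ϑ γ hγ).2.1, integral_Ioi_Ptail]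
  have hint_pos : 0 < ∫ x in Ioi (Sstar θ γ - θ), Ptail α 0 x := by
    rw [← hSeq θ]
    exact mul_pos hcpos (hSpos θ)
  have hC0 : C0 α ≠ 0 := by
    intro h
    simp [Ptail, fd, h] at hint_pos
  have hPint : IntegrableOn (Ptail α 0) (Ioi (Sstar θ γ - θ)) := by
    by_contra hn
    exact hint_pos.ne' (integral_undef hn)
  have hφ : ∀ v, HasDerivAt (fun t => (∫ x in Ioi t, Ptail α 0 x) / c - t)
      (-Ptail α 0 v / c - 1) v := fun v =>
    ((hasDerivAt_integral_Ioi (continuous_Ptail_zero hα0 hC0) hPint v).div_const c).sub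
      (hasDerivAt_id v)
  have hneg : ∀ v, -Ptail α 0 v / c - 1 < 0 := fun v => by
    have h := div_pos (Ptail_zero_pos hC0 v) hcpos
    rw [neg_div]
    linarith
  have hinv : Function.RightInverse (fun ϑ => Sstar ϑ γ - ϑ)
      (fun t => (∫ x in Ioi t, Ptail α 0 x) / c - t) := fun ϑ => by
    simp only [← hSeq ϑ]
    field_simp
    ring
  have hderiv := (hasDerivAt_of_rightInverse_of_deriv_neg hφ hneg hinv θ).add (hasDerivAt_id θ)
  have hbellman : c * Sstar θ γ = ∫ x in Ioi (Sstar θ γ), Ptail α θ x := by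
    rw [hc, (hS θ γ hγ).2.1]
  have hP : 0 < Ptail α θ (Sstar θ γ) := by
    rw [Ptail_eq_Ptail_zero]
    exact Ptail_zero_pos hC0 _
  simp only [← Ptail_eq_Ptail_zero] at hderiv
  have hs := hSpos θ
  rw [gfun, ← hbellman, ← hc]
  generalize Ptail α θ (Sstar θ γ) = p at hP hderiv ⊢
  refine ⟨?_, ⟨by positivity, ?_⟩, ?_⟩
  · have hfun : (fun ϑ => Sstar ϑ γ) = (fun ϑ => Sstar ϑ γ - ϑ) + id := by
      ext ϑ
      simp
    have hval : p / (p + c) = (-p / c - 1)⁻¹ + 1 := by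
      have h : -p / c - 1 = -((p + c) / c) := by
        field_simp
        ring
      rw [h]
      field_simp
      ring
    rw [hfun, hval]
    exact hderiv
  · rw [div_lt_one (by positivity)]
    linarith
  · field_simp
    ring
end
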